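/- Let ι be a type, μ : ι → ℝ, and let S*, S be nonempty finite subsets of ι with |S*| = |S| = N. Assume S* consists of N largest values of μ, i.e., for every i ∈ S* and every j ∉ S*, μ(j) ≤ μ(i). Then (min over k ∈ S* of μ(k)) − (min over k ∈ S of μ(k)) ≤ (Σ_{k ∈ S*} μ(k)) − (Σ_{k ∈ S} μ(k)). -/

import Mathlib

/-- Per-round regret bound (eq (eq xl), Appendix A): if `S*` consists of `N` largest
values of `μ` and `|S*| = |S| = N`, then
`min_{k∈S*} μ k - min_{k∈S} μ k ≤ Σ_{k∈S*} μ k - Σ_{k∈S} μ k`. -/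
theorem min_regret_le_sum_regret {ι : Type*} [DecidableEq ι] (μ : ι → ℝ)
    (N : ℕ) (Sstar S : Finset ι) (hstar : Sstar.Nonempty) (hS : S.Nonempty)
    (hcardstar : Sstar.card = N) (hcard : S.card = N)
    (htop : ∀ i ∈ Sstar, ∀ j ∉ Sstar, μ j ≤ μ i) :
    Sstar.inf' hstar μ - S.inf' hS μ ≤ (∑ k ∈ Sstar, μ k) - ∑ k ∈ S, μ k := by
  obtain ⟨a, haS, ha⟩ := S.exists_mem_eq_inf' hS μ
  obtain ⟨b, hb, hmin⟩ := Sstar.exists_mem_eq_inf' hstar μ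
  have hle : ∀ k ∈ Sstar, μ b ≤ μ k := fun k hk => hmin ▸ Finset.inf'_le μ hk
  rw [ha, hmin]
  have hdiff : (∑ k ∈ Sstar, μ k) - ∑ k ∈ S, μ k
      = ∑ k ∈ Sstar \ S, (μ k - μ b) + ∑ k ∈ S \ Sstar, (μ b - μ k) := by
    have hcards : (Sstar \ S).card = (S \ Sstar).card :=
      Finset.card_sdiff_comm (hcardstar.trans hcard.symm)
    rw [← Finset.sum_sdiff_sub_sum_sdiff, Finset.sum_sub_distrib, Finset.sum_sub_distrib,
      Finset.sum_const, Finset.sum_const, hcards]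
    ring
  have hgain : 0 ≤ ∑ k ∈ Sstar \ S, (μ k - μ b) :=
    Finset.sum_nonneg fun k hk => sub_nonneg.2 (hle k (Finset.mem_sdiff.1 hk).1)
  have hloss : ∀ k ∈ S \ Sstar, 0 ≤ μ b - μ k := fun k hk =>
    sub_nonneg.2 (htop b hb k (Finset.mem_sdiff.1 hk).2)
  rw [hdiff]
  by_cases hastar : a ∈ Sstar
  · linarith [hle a hastar, Finset.sum_nonneg hloss]
  · linarith [Finset.single_le_sum hloss (Finset.mem_sdiff.2 ⟨haS, hastar⟩)]
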